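/- Let X be a local dendrite and let G be a subcontinuum of X. The following are equivalent: (1) G contains every simple closed curve of X; (2) G is a deformation retract of X, i.e., there exist a continuous retraction r : X → X with image G and r restricting to the identity on G, and a continuous homotopy h : [0,1] × X → X with h(0,x) = x and h(1,x) = r(x) for all x; (3) G is a strong deformation retract of X, i.e., such r and h exist with additionally h(t,g) = g for all t ∈ [0,1] and g ∈ G. -/

import Mathlib

open Topology

/-- A continuum: a nonempty compact connected metrizable topological space. -/
def IsContinuum (X : Type*) [TopologicalSpace X] : Prop :=
  Nonempty X ∧ CompactSpace X ∧ ConnectedSpace X ∧ TopologicalSpace.MetrizableSpace X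

/-- A simple closed curve in `X`: a subspace homeomorphic to the circle. -/
def IsSimpleClosedCurve {X : Type*} [TopologicalSpace X] (S : Set X) : Prop :=
  Nonempty (S ≃ₜ AddCircle (1 : ℝ))

/-- A dendrite: a locally connected continuum containing no simple closed curve. -/
def IsDendrite (X : Type*) [TopologicalSpace X] : Prop :=
  IsContinuum X ∧ LocallyConnectedSpace X ∧ ∀ S : Set X, ¬ IsSimpleClosedCurve S

/-- A local dendrite: a continuum each of whose points has a neighborhood
that is a dendrite. -/
def IsLocalDendrite (X : Type*) [TopologicalSpace X] : Prop :=
  IsContinuum X ∧ ∀ x : X, ∃ N : Set X, N ∈ 𝓝 x ∧ IsDendrite N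

/-- A branch point of `X`: a point whose complement has at least three
connected components. -/
def IsBranchPoint {X : Type*} [TopologicalSpace X] (x : X) : Prop :=
  ∃ u v w : ConnectedComponents (↥({x}ᶜ : Set X)), u ≠ v ∧ u ≠ w ∧ v ≠ w

/-- `X ∖ {x}` has countably infinitely many connected components
(i.e. there are ℵ₀ branches at `x`). -/
def HasAlephNullBranchesAt (X : Type*) [TopologicalSpace X] (x : X) : Prop :=
  Countable (ConnectedComponents (↥({x}ᶜ : Set X))) ∧
    Infinite (ConnectedComponents (↥({x}ᶜ : Set X)))

open Set Filter

/-- A finite chain of connected open sets, with closures inside `U`, from `a` to `b`: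
consecutive points `pt i` and `pt (i + 1)` lie in the `i`-th link. -/
structure ConnectedChain {X : Type*} [TopologicalSpace X] (U : Set X) (a b : X) where
  len : ℕ
  len_pos : 0 < len
  pt : ℕ → X
  link : ℕ → Set X
  pt_zero : pt 0 = a
  pt_len : pt len = b
  isOpen_link : ∀ i < len, IsOpen (link i)
  isPreconnected_link : ∀ i < len, IsPreconnected (link i)
  closure_link_subset : ∀ i < len, closure (link i) ⊆ U
  pt_mem : ∀ i < len, pt i ∈ link i
  pt_succ_mem : ∀ i < len, pt (i + 1) ∈ link i

namespace ConnectedChain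

/-- All links have diameter at most `ε`. -/
def MeshLE {X : Type*} [PseudoMetricSpace X] {U : Set X} {a b : X} (c : ConnectedChain U a b)
    (ε : ℝ) : Prop :=
  ∀ i < c.len, ∀ y ∈ c.link i, ∀ z ∈ c.link i, dist y z ≤ ε

/-- A single link seen as a chain. -/
def single {X : Type*} [TopologicalSpace X] {U : Set X} {a b : X} (V : Set X) (hV : IsOpen V)
    (hc : IsPreconnected V) (hU : closure V ⊆ U) (ha : a ∈ V) (hb : b ∈ V) :
    ConnectedChain U a b where
  len := 1
  len_pos := one_pos
  pt i := if i = 0 then a else b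
  link _ := V
  pt_zero := by simp
  pt_len := by simp
  isOpen_link _ _ := hV
  isPreconnected_link _ _ := hc
  closure_link_subset _ _ := hU
  pt_mem i _ := by split_ifs <;> assumption
  pt_succ_mem i _ := by simpa

/-- Add a link at the beginning of a chain. -/
def cons {X : Type*} [TopologicalSpace X] {U : Set X} {a b d : X} (V : Set X) (hV : IsOpen V)
    (hc : IsPreconnected V) (hU : closure V ⊆ U) (ha : a ∈ V) (hb : b ∈ V)
    (c : ConnectedChain U b d) : ConnectedChain U a d where
  len := c.len + 1
  len_pos := Nat.succ_pos _
  pt i := Nat.casesOn i a c.pt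
  link i := Nat.casesOn i V c.link
  pt_zero := rfl
  pt_len := c.pt_len
  isOpen_link i hi := by
    cases i with
    | zero => exact hV
    | succ i => exact c.isOpen_link i (by omega)
  isPreconnected_link i hi := by
    cases i with
    | zero => exact hc
    | succ i => exact c.isPreconnected_link i (by omega)
  closure_link_subset i hi := by
    cases i with
    | zero => exact hU
    | succ i => exact c.closure_link_subset i (by omega)
  pt_mem i hi := by
    cases i with
    | zero => exact ha
    | succ i => exact c.pt_mem i (by omega)
  pt_succ_mem i hi := by
    cases i with
    | zero => simpa [c.pt_zero] using hb
    | succ i => exact c.pt_succ_mem i (by omega)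

/-- Repeat the last link of a chain to increase its length. -/
def pad {X : Type*} [TopologicalSpace X] {U : Set X} {a b : X} (c : ConnectedChain U a b)
    (n : ℕ) (hn : c.len ≤ n) : ConnectedChain U a b where
  len := n
  len_pos := c.len_pos.trans_le hn
  pt i := c.pt (min i c.len)
  link i := c.link (min i (c.len - 1))
  pt_zero := by simp [c.pt_zero]
  pt_len := by simp [hn, c.pt_len]
  isOpen_link i _ := c.isOpen_link _ (by have := c.len_pos; omega)
  isPreconnected_link i _ := c.isPreconnected_link _ (by have := c.len_pos; omega)
  closure_link_subset i _ := c.closure_link_subset _ (by have := c.len_pos; omega)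
  pt_mem i _ := by
    have := c.len_pos
    rcases lt_or_ge i c.len with h | h
    · rw [min_eq_left h.le, min_eq_left (by omega)]
      exact c.pt_mem i h
    · rw [min_eq_right h, min_eq_right (by omega)]
      simpa [Nat.sub_add_cancel this] using c.pt_succ_mem (c.len - 1) (by omega)
  pt_succ_mem i _ := by
    have := c.len_pos
    rcases lt_or_ge i c.len with h | h
    · rw [min_eq_left (by omega), min_eq_left (by omega)]
      exact c.pt_succ_mem i h
    · rw [min_eq_right (by omega), min_eq_right (by omega)]
      simpa [Nat.sub_add_cancel this] using c.pt_succ_mem (c.len - 1) (by omega)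

theorem exists_meshLE {X : Type*} [PseudoMetricSpace X] [LocallyConnectedSpace X] {U : Set X}
    (hU : IsOpen U) (hc : IsPreconnected U) {a b : X} (ha : a ∈ U) (hb : b ∈ U) {ε : ℝ}
    (hε : 0 < ε) : ∃ c : ConnectedChain U a b, c.MeshLE ε := by
  let R : X → X → Prop := fun y z ↦ ∃ V : Set X, IsOpen V ∧ IsPreconnected V ∧ closure V ⊆ U ∧
    (∀ p ∈ V, ∀ q ∈ V, dist p q ≤ ε) ∧ y ∈ V ∧ z ∈ V
  have hR : ∀ y z, R y z → R z y := fun y z ⟨V, h1, h2, h3, h4, h5, h6⟩ ↦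
    ⟨V, h1, h2, h3, h4, h6, h5⟩
  have key : Relation.TransGen R a b := by
    refine hc.induction₂ (Relation.TransGen R) (fun x hx ↦ ?_) (fun x y z _ _ _ ↦ .trans)
      (fun x y _ _ h ↦ ?_) ha hb
    · obtain ⟨r, hr, hrU⟩ := Metric.nhds_basis_closedBall.mem_iff.1 (hU.mem_nhds hx)
      have hpos : 0 < min r (ε / 2) := lt_min hr (half_pos hε)
      have hsub := connectedComponentIn_subset (Metric.ball x (min r (ε / 2))) x
      have hnhds := connectedComponentIn_mem_nhds (Metric.ball_mem_nhds x hpos)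
      filter_upwards [mem_nhdsWithin_of_mem_nhds hnhds] with y hy
      refine .single ⟨_, Metric.isOpen_ball.connectedComponentIn, isPreconnected_connectedComponentIn,
        ?_, fun p hp q hq ↦ ?_, mem_of_mem_nhds hnhds, hy⟩
      · exact (closure_mono hsub).trans (Metric.closure_ball_subset_closedBall.trans
          ((Metric.closedBall_subset_closedBall (min_le_left _ _)).trans hrU))
      · have h1 := Metric.mem_ball.1 (hsub hp)
        have h2 := Metric.mem_ball.1 (hsub hq)
        have h3 := dist_triangle_right p q x
        have h4 := min_le_right r (ε / 2)
        linarith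
    · exact Std.Symm.symm (self := @Relation.TransGen.stdSymm _ _ ⟨hR⟩) _ _ h
  induction key using Relation.TransGen.head_induction_on with
  | single h =>
    obtain ⟨V, h1, h2, h3, h4, h5, h6⟩ := h
    exact ⟨single V h1 h2 h3 h5 h6, fun _ _ ↦ h4⟩
  | head h _ ih =>
    obtain ⟨V, h1, h2, h3, h4, h5, h6⟩ := h
    obtain ⟨c, hcm⟩ := ih (h3 (subset_closure h6))
    refine ⟨cons V h1 h2 h3 h5 h6 c, fun i hi ↦ ?_⟩
    cases i with
    | zero => exact h4
    | succ i => exact hcm i (by simpa [cons] using hi)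

/-- `d` refines `c` uniformly: each link of `c` is subdivided into the same number of links. -/
def Refines {X : Type*} [TopologicalSpace X] {U : Set X} {a b : X}
    (d c : ConnectedChain U a b) : Prop :=
  ∃ N, 0 < N ∧ d.len = c.len * N ∧ ∀ k < d.len, d.link k ⊆ c.link (k / N)

theorem exists_refines {X : Type*} [PseudoMetricSpace X] [LocallyConnectedSpace X] {U : Set X}
    {a b : X} (c : ConnectedChain U a b) {ε : ℝ} (hε : 0 < ε) :
    ∃ d : ConnectedChain U a b, d.Refines c ∧ d.MeshLE ε := by
  have h : ∀ i : Fin c.len, ∃ e : ConnectedChain (c.link i) (c.pt i) (c.pt (i + 1)), e.MeshLE ε :=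
    fun i ↦ exists_meshLE (c.isOpen_link i i.2) (c.isPreconnected_link i i.2) (c.pt_mem i i.2)
      (c.pt_succ_mem i i.2) hε
  choose e he using h
  obtain ⟨N, hN⟩ : ∃ N, ∀ i, (e i).len ≤ N :=
    ⟨Finset.univ.sup fun i ↦ (e i).len, fun i ↦
      Finset.le_sup (f := fun i ↦ (e i).len) (Finset.mem_univ i)⟩
  have hN0 : 0 < N := (e ⟨0, c.len_pos⟩).len_pos.trans_le (hN _)
  let f := fun i : Fin c.len ↦ (e i).pad N (hN i)
  have hf : ∀ i, (f i).MeshLE ε := fun i j _ ↦ he i _ (by have := (e i).len_pos; omega)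
  let y : ℕ → ℕ → X := fun i j ↦ if h : i < c.len then (f ⟨i, h⟩).pt j else b
  let W : ℕ → ℕ → Set X := fun i j ↦ if h : i < c.len then (f ⟨i, h⟩).link j else ∅
  have hy : ∀ i (h : i < c.len) j, y i j = (f ⟨i, h⟩).pt j := fun i h j ↦ dif_pos h
  have hW : ∀ i (h : i < c.len) j, W i j = (f ⟨i, h⟩).link j := fun i h j ↦ dif_pos h
  have hy0 : ∀ i ≤ c.len, y i 0 = c.pt i := fun i hi ↦ by
    rcases hi.lt_or_eq with h | rfl
    · rw [hy i h, (f ⟨i, h⟩).pt_zero]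
    · simp [y, c.pt_len]
  have hyN : ∀ i < c.len, y i N = c.pt (i + 1) := fun i hi ↦ by
    rw [hy i hi]
    exact (f ⟨i, hi⟩).pt_len
  have hlt : ∀ {k}, k < c.len * N → k / N < c.len := fun hk ↦ Nat.div_lt_of_lt_mul (by
    rwa [mul_comm])
  have hmod : ∀ k, k % N < N := fun k ↦ Nat.mod_lt k hN0
  refine ⟨{
    len := c.len * N
    len_pos := Nat.mul_pos c.len_pos hN0
    pt := fun k ↦ y (k / N) (k % N)
    link := fun k ↦ W (k / N) (k % N)
    pt_zero := by simp [hy0, c.pt_zero]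
    pt_len := by simp [hN0, hy0, c.pt_len]
    isOpen_link := fun k hk ↦ ?_
    isPreconnected_link := fun k hk ↦ ?_
    closure_link_subset := fun k hk ↦ ?_
    pt_mem := fun k hk ↦ ?_
    pt_succ_mem := fun k hk ↦ ?_ }, ⟨N, hN0, rfl, fun k hk ↦ ?_⟩, fun k hk ↦ ?_⟩
  · rw [hW _ (hlt hk)]
    exact (f _).isOpen_link _ (hmod k)
  · rw [hW _ (hlt hk)]
    exact (f _).isPreconnected_link _ (hmod k)
  · rw [hW _ (hlt hk)]
    exact ((f _).closure_link_subset _ (hmod k)).trans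
      (subset_closure.trans (c.closure_link_subset _ (hlt hk)))
  · rw [hW _ (hlt hk), hy _ (hlt hk)]
    exact (f _).pt_mem _ (hmod k)
  · have hs := (f ⟨k / N, hlt hk⟩).pt_succ_mem _ (hmod k)
    rw [← hy, ← hW] at hs
    convert hs using 1
    have hdm := Nat.div_add_mod k N
    rcases (Nat.succ_le_of_lt (hmod k)).lt_or_eq with h | h
    · have hk1 : k + 1 = N * (k / N) + (k % N + 1) := by omega
      have h1 : (k + 1) / N = k / N := by
        rw [hk1, Nat.mul_add_div hN0, Nat.div_eq_of_lt h, add_zero]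
      have h2 : (k + 1) % N = k % N + 1 := by
        rw [hk1, Nat.mul_add_mod, Nat.mod_eq_of_lt h]
      rw [h1, h2]
    · have h' : k % N + 1 = N := h
      have hk1 : k + 1 = N * (k / N + 1) := by rw [mul_add]; omega
      have h1 : (k + 1) / N = k / N + 1 := by rw [hk1, Nat.mul_div_cancel_left _ hN0]
      have h2 : (k + 1) % N = 0 := by rw [hk1, Nat.mul_mod_right]
      rw [h1, h2, h', hyN _ (hlt hk), hy0 _ (hlt hk)]
  · change W _ _ ⊆ _
    rw [hW _ (hlt hk)]
    exact subset_closure.trans ((f _).closure_link_subset _ (hmod k))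
  · change ∀ y ∈ W _ _, ∀ z ∈ W _ _, _
    rw [hW _ (hlt hk)]
    exact hf _ _ (hmod k)

end ConnectedChain

theorem ConnectedChain.exists_seq {X : Type*} [PseudoMetricSpace X] [LocallyConnectedSpace X]
    {U : Set X} (hU : IsOpen U) (hc : IsPreconnected U) {a b : X} (ha : a ∈ U) (hb : b ∈ U) :
    ∃ c : ℕ → ConnectedChain U a b,
      (∀ n, (c n).MeshLE ((1 / 2) ^ n)) ∧ ∀ n, (c (n + 1)).Refines (c n) := by
  obtain ⟨c₀, hc₀⟩ := exists_meshLE hU hc ha hb (one_pos (α := ℝ))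
  choose d hd using fun (n : ℕ) (c : ConnectedChain U a b) ↦
    c.exists_refines (ε := (1 / 2) ^ n) (by positivity)
  refine ⟨fun n ↦ Nat.rec c₀ (fun n c ↦ d (n + 1) c) n, fun n ↦ ?_, fun n ↦ (hd _ _).1⟩
  cases n with
  | zero => simpa using hc₀
  | succ n => exact (hd _ _).2

/-- In a complete locally connected metric space, open connected sets are path-connected. -/
theorem IsPreconnected.joinedIn_of_isOpen {X : Type*} [MetricSpace X] [CompleteSpace X]
    [LocallyConnectedSpace X] {U : Set X} (hc : IsPreconnected U) (hU : IsOpen U) {a b : X}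
    (ha : a ∈ U) (hb : b ∈ U) : JoinedIn U a b := by
  obtain ⟨c, hmesh, href⟩ := ConnectedChain.exists_seq hU hc ha hb
  let idx : ℕ → unitInterval → ℕ := fun n t ↦ ⌊(t : ℝ) * (c n).len⌋₊
  let g : ℕ → unitInterval → X := fun n t ↦ (c n).pt (idx n t)
  have hlen : ∀ n, (0 : ℝ) < (c n).len := fun n ↦ Nat.cast_pos.2 (c n).len_pos
  have idx_lt : ∀ n (t : unitInterval), t < 1 → idx n t < (c n).len := fun n t ht ↦ by
    refine (Nat.floor_lt (mul_nonneg t.2.1 (hlen n).le)).2 ?_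
    have h : (t : ℝ) < 1 := ht
    nlinarith [hlen n]
  have idx_one : ∀ n, idx n 1 = (c n).len := fun n ↦ by simp [idx]
  have g_one : ∀ n, g n 1 = b := fun n ↦ by simp only [g, idx_one, (c n).pt_len]
  have g_zero : ∀ n, g n 0 = a := fun n ↦ by simp [g, idx, (c n).pt_zero]
  have link_sub : ∀ n m, n ≤ m → ∀ t : unitInterval, t < 1 →
      (c m).link (idx m t) ⊆ (c n).link (idx n t) := by
    intro n m hnm t ht
    induction m, hnm using Nat.le_induction with
    | base => exact subset_rfl
    | succ m _ ih =>
      obtain ⟨N, hN, hlen', hsub⟩ := href m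
      refine Subset.trans ?_ ih
      have : idx m t = idx (m + 1) t / N := by
        have hN' : (N : ℝ) ≠ 0 := Nat.cast_ne_zero.2 hN.ne'
        change _ = ⌊(t : ℝ) * (c (m + 1)).len⌋₊ / N
        rw [← Nat.floor_div_natCast, hlen', Nat.cast_mul, ← mul_assoc, mul_div_cancel_right₀ _ hN']
      rw [this]
      exact hsub _ (idx_lt _ t ht)
  have g_mem : ∀ n m, n ≤ m → ∀ t : unitInterval, t < 1 → g m t ∈ (c n).link (idx n t) :=
    fun n m hnm t ht ↦ link_sub n m hnm t ht ((c m).pt_mem _ (idx_lt m t ht))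
  have g_dist : ∀ N n m, N ≤ n → N ≤ m → ∀ t, dist (g n t) (g m t) ≤ (1 / 2) ^ N := by
    intro N n m hn hm t
    rcases (unitInterval.le_one' (t := t)).lt_or_eq with ht | rfl
    · exact hmesh N _ (idx_lt N t ht) _ (g_mem N n hn t ht) _ (g_mem N m hm t ht)
    · rw [g_one, g_one, dist_self]
      positivity
  have hpow : Tendsto (fun n : ℕ ↦ (1 / 2 : ℝ) ^ n) atTop (𝓝 0) :=
    tendsto_pow_atTop_nhds_zero_of_lt_one (by norm_num) (by norm_num)
  have hlim : ∀ t, ∃ x, Tendsto (fun n ↦ g n t) atTop (𝓝 x) := fun t ↦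
    cauchySeq_tendsto_of_complete (cauchySeq_of_le_tendsto_0 _
      (fun n m N hn hm ↦ g_dist N n m hn hm t) hpow)
  choose G hG using hlim
  have hGdist : ∀ n t, dist (g n t) (G t) ≤ (1 / 2) ^ n := fun n t ↦
    le_of_tendsto (tendsto_const_nhds.dist (hG t))
      (eventually_atTop.2 ⟨n, fun m hm ↦ g_dist n n m le_rfl hm t⟩)
  have hstep : ∀ n (s t : unitInterval), s ≤ t → dist s t < 1 / (c n).len →
      dist (g n s) (g n t) ≤ (1 / 2) ^ n := by
    intro n s t hst hd
    rcases (unitInterval.le_one' (t := s)).lt_or_eq with hs | rfl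
    · have hst' : (s : ℝ) ≤ t := hst
      have h1 : idx n s ≤ idx n t := Nat.floor_mono (by gcongr)
      have h2 : idx n t ≤ idx n s + 1 := by
        rw [← Nat.floor_add_one (mul_nonneg s.2.1 (hlen n).le)]
        refine Nat.floor_mono ?_
        rw [Subtype.dist_eq, Real.dist_eq, abs_sub_comm, abs_of_nonneg (sub_nonneg.2 hst'),
          lt_div_iff₀ (hlen n)] at hd
        linarith
      have hi := idx_lt n s hs
      refine hmesh n _ hi _ ((c n).pt_mem _ hi) _ ?_
      rcases Nat.le_and_le_add_one_iff.1 ⟨h1, h2⟩ with h | h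
      · simp only [g, h, (c n).pt_mem _ hi]
      · simp only [g, h, (c n).pt_succ_mem _ hi]
    · rw [le_antisymm unitInterval.le_one' hst, dist_self]
      positivity
  have hcont : Continuous G := by
    rw [Metric.continuous_iff]
    intro t ε hε
    obtain ⟨n, hn⟩ := exists_pow_lt_of_lt_one (show 0 < ε / 3 by positivity)
      (show (1 / 2 : ℝ) < 1 by norm_num)
    refine ⟨1 / (c n).len, div_pos one_pos (hlen n), fun s hs ↦ ?_⟩
    have h1 : dist (g n s) (g n t) ≤ (1 / 2) ^ n := by
      rcases le_total s t with h | h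
      · exact hstep n s t h hs
      · rw [dist_comm]
        exact hstep n t s h (by rwa [dist_comm])
    have h2 := dist_triangle4 (G s) (g n s) (g n t) (G t)
    have h3 := hGdist n s
    have h4 := hGdist n t
    rw [dist_comm] at h3
    linarith
  refine ⟨⟨⟨G, hcont⟩, ?_, ?_⟩, fun t ↦ ?_⟩
  · refine tendsto_nhds_unique (hG 0) ?_
    simp only [g_zero, tendsto_const_nhds]
  · refine tendsto_nhds_unique (hG 1) ?_
    simp only [g_one, tendsto_const_nhds]
  · rcases (unitInterval.le_one' (t := t)).lt_or_eq with ht | rfl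
    · exact (c 0).closure_link_subset _ (idx_lt 0 t ht)
        (mem_closure_of_tendsto (hG t) (.of_forall fun n ↦ g_mem 0 n n.zero_le t ht))
    · have : G 1 = b := tendsto_nhds_unique (hG 1) (by simp only [g_one, tendsto_const_nhds])
      exact this ▸ hb

/-- A continuously varying family of closed sets in a compact metric space has a continuous
strictly monotone size function. -/
theorem exists_continuous_strictMono_size {T X : Type*} [TopologicalSpace T] [MetricSpace X]
    [CompactSpace X] [Nonempty X] (B : T → Set X) (hne : ∀ t, (B t).Nonempty)
    (hcl : ∀ t, IsClosed (B t))
    (hB : ∀ t, ∀ ε > 0, ∀ᶠ t' in 𝓝 t, (∀ y ∈ B t, ∃ y' ∈ B t', dist y y' ≤ ε) ∧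
      ∀ y ∈ B t', ∃ y' ∈ B t, dist y y' ≤ ε) :
    ∃ μ : T → ℝ, Continuous μ ∧ ∀ s t, B s ⊆ B t → μ s ≤ μ t ∧ (μ t ≤ μ s → B t ⊆ B s) := by
  let q := TopologicalSpace.denseSeq X
  have hbdd : ∀ s : Set X, Bornology.IsBounded s := fun s ↦ Metric.isBounded_of_compactSpace
  have hle : ∀ n t, Metric.infDist (q n) (B t) ≤ Metric.diam (univ : Set X) := fun n t ↦ by
    obtain ⟨y, hy⟩ := hne t
    exact (Metric.infDist_le_dist_of_mem hy).trans
      (Metric.dist_le_diam_of_mem (hbdd _) (mem_univ _) (mem_univ _))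
  have hinf : ∀ x, Continuous fun t ↦ Metric.infDist x (B t) := by
    intro x
    refine continuous_iff_continuousAt.2 fun t ↦ Metric.tendsto_nhds.2 fun ε hε ↦ ?_
    filter_upwards [hB t (ε / 2) (half_pos hε)] with t' ht'
    have hH : Metric.hausdorffDist (B t) (B t') ≤ ε / 2 :=
      Metric.hausdorffDist_le_of_mem_dist (half_pos hε).le ht'.1 ht'.2
    have hfin := Metric.hausdorffEDist_ne_top_of_nonempty_of_bounded (hne t) (hne t')
      (hbdd _) (hbdd _)
    have hfin' := Metric.hausdorffEDist_ne_top_of_nonempty_of_bounded (hne t') (hne t)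
      (hbdd _) (hbdd _)
    have h1 := Metric.infDist_le_infDist_add_hausdorffDist (x := x) hfin
    have h2 := Metric.infDist_le_infDist_add_hausdorffDist (x := x) hfin'
    rw [Metric.hausdorffDist_comm] at h2
    rw [Real.dist_eq, abs_lt]
    constructor <;> linarith
  have hsum : Summable fun n : ℕ ↦ (1 / 2 : ℝ) ^ n * Metric.diam (univ : Set X) :=
    summable_geometric_two.mul_right _
  have hbound : ∀ n t, ‖(1 / 2 : ℝ) ^ n * Metric.infDist (q n) (B t)‖ ≤
      (1 / 2) ^ n * Metric.diam (univ : Set X) := fun n t ↦ by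
    rw [Real.norm_of_nonneg (mul_nonneg (by positivity) Metric.infDist_nonneg)]
    exact mul_le_mul_of_nonneg_left (hle n t) (by positivity)
  have hsum' : ∀ t, Summable fun n : ℕ ↦ (1 / 2 : ℝ) ^ n * Metric.infDist (q n) (B t) :=
    fun t ↦ hsum.of_norm_bounded fun n ↦ hbound n t
  refine ⟨fun t ↦ -∑' n : ℕ, (1 / 2 : ℝ) ^ n * Metric.infDist (q n) (B t),
    (continuous_tsum (fun n ↦ continuous_const.mul (hinf _)) hsum hbound).neg, fun s t hst ↦ ?_⟩
  have hmono : ∀ n, (1 / 2 : ℝ) ^ n * Metric.infDist (q n) (B t) ≤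
      (1 / 2 : ℝ) ^ n * Metric.infDist (q n) (B s) := fun n ↦
    mul_le_mul_of_nonneg_left (Metric.infDist_le_infDist_of_subset hst (hne s)) (by positivity)
  refine ⟨neg_le_neg ((hsum' t).tsum_le_tsum hmono (hsum' s)), fun h y hy ↦ ?_⟩
  by_contra hys
  have hpos := ((hcl s).notMem_iff_infDist_pos (hne s)).1 hys
  obtain ⟨n, hn⟩ := (TopologicalSpace.denseRange_denseSeq X).exists_mem_open
    (Metric.isOpen_ball (x := y) (ε := Metric.infDist y (B s) / 2)) ⟨y, by simpa using hpos⟩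
  have hn' : dist (q n) y < Metric.infDist y (B s) / 2 := hn
  have h1 : Metric.infDist (q n) (B t) ≤ dist (q n) y := Metric.infDist_le_dist_of_mem hy
  have h2 : Metric.infDist y (B s) ≤ Metric.infDist (q n) (B s) + dist y (q n) :=
    Metric.infDist_le_infDist_add_dist
  rw [dist_comm] at h2
  have h3 : (1 / 2 : ℝ) ^ n * Metric.infDist (q n) (B t) <
      (1 / 2 : ℝ) ^ n * Metric.infDist (q n) (B s) :=
    mul_lt_mul_of_pos_left (by linarith) (by positivity)
  exact absurd h (not_le.2 (neg_lt_neg ((hsum' t).tsum_lt_tsum hmono h3 (hsum' s))))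

/-- A path in a Hausdorff space can be restricted to a closed set of times, all of whose gaps
are loops, and on which only endpoints of gaps are identified. -/
theorem exists_isClosed_forall_gap {X : Type*} [TopologicalSpace X] [T2Space X]
    {γ : unitInterval → X} (hγ : Continuous γ) :
    ∃ K : Set unitInterval, IsClosed K ∧ 0 ∈ K ∧ 1 ∈ K ∧
      (∀ s ∈ K, ∀ t ∈ K, s < t → (Disjoint (Ioo s t) K ↔ γ s = γ t)) := by
  let S : Set (Set unitInterval) := {K | IsClosed K ∧ 0 ∈ K ∧ 1 ∈ K ∧
    ∀ s ∈ K, ∀ t ∈ K, s < t → Disjoint (Ioo s t) K → γ s = γ t}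
  have huniv : univ ∈ S := ⟨isClosed_univ, mem_univ _, mem_univ _, fun s _ t _ hst h ↦
    absurd (disjoint_univ.1 h) (nonempty_Ioo.2 hst).ne_empty⟩
  have hchain : ∀ c ⊆ S, IsChain (· ⊆ ·) c → c.Nonempty → ∃ lb ∈ S, ∀ K ∈ c, lb ⊆ K := by
    intro c hcS hc hcne
    refine ⟨⋂₀ c, ⟨isClosed_sInter fun K hK ↦ (hcS hK).1, fun K hK ↦ (hcS hK).2.1,
      fun K hK ↦ (hcS hK).2.2.1, fun s hs t ht hst hd ↦ ?_⟩, fun K hK ↦ sInter_subset_of_mem hK⟩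
    by_contra hne
    obtain ⟨A, B, hA, hB, hsA, htB, hAB⟩ := t2_separation hne
    obtain ⟨u, hsu, hu⟩ := exists_Ico_subset_of_mem_nhds
      ((hA.preimage hγ).mem_nhds hsA) ⟨t, hst⟩
    obtain ⟨v, hvt, hv⟩ := exists_Ioc_subset_of_mem_nhds
      ((hB.preimage hγ).mem_nhds htB) ⟨s, hst⟩
    have huv : u ≤ v := by
      by_contra hlt
      obtain ⟨w, hw1, hw2⟩ := exists_between
        (max_lt (lt_min hsu hst) (lt_min (not_le.1 hlt) hvt) : max s v < min u t)
      exact disjoint_left.1 hAB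
        (hu ⟨(le_max_left _ _).trans hw1.le, hw2.trans_le (min_le_left _ _)⟩ : γ w ∈ A)
        (hv ⟨(le_max_right _ _).trans_lt hw1, hw2.le.trans (min_le_right _ _)⟩)
    have : Nonempty c := hcne.to_subtype
    obtain ⟨⟨K, hKc⟩, hK⟩ := (isCompact_Icc (a := u) (b := v)).elim_directed_family_closed
      (fun K : c ↦ (K : Set unitInterval)) (fun K ↦ (hcS K.2).1)
      (by
        rw [← sInter_eq_iInter, ← disjoint_iff_inter_eq_empty]
        exact hd.mono_left (Icc_subset_Ioo hsu hvt))
      (fun K L ↦ (hc.total K.2 L.2).elim (fun h ↦ ⟨K, subset_rfl, h⟩) fun h ↦ ⟨L, h, subset_rfl⟩)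
    have hK' : ∀ w ∈ K, u ≤ w → w ≤ v → False := fun w hw h1 h2 ↦
      (hK.subset ⟨⟨h1, h2⟩, hw⟩ : w ∈ (∅ : Set unitInterval))
    obtain ⟨hKcl, -, -, hgap⟩ := hcS hKc
    obtain ⟨s₀, ⟨⟨hs0, hs0u⟩, hs0K⟩, hs0'⟩ := ((isCompact_Icc (a := s) (b := u)).inter_right
      hKcl).exists_isGreatest ⟨s, ⟨le_rfl, hsu.le⟩, hs K hKc⟩
    obtain ⟨t₀, ⟨⟨ht0v, ht0⟩, ht0K⟩, ht0'⟩ := ((isCompact_Icc (a := v) (b := t)).inter_right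
      hKcl).exists_isLeast ⟨t, ⟨hvt.le, le_rfl⟩, ht K hKc⟩
    have hs0u' : s₀ < u := hs0u.lt_of_ne fun h ↦ hK' s₀ hs0K h.ge (h.trans_le huv)
    have ht0v' : v < t₀ := ht0v.lt_of_ne fun h ↦ hK' t₀ ht0K (huv.trans h.le) h.ge
    have heq : γ s₀ = γ t₀ := by
      refine hgap s₀ hs0K t₀ ht0K (hs0u'.trans_le (huv.trans ht0v'.le))
        (disjoint_left.2 fun w hw hwK ↦ ?_)
      rcases le_total w u with h | h
      · exact (hs0' ⟨⟨hs0.trans hw.1.le, h⟩, hwK⟩).not_gt hw.1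
      · rcases le_total v w with h' | h'
        · exact (ht0' ⟨⟨h', hw.2.le.trans ht0⟩, hwK⟩).not_gt hw.2
        · exact hK' w hwK h h'
    have hs0A : γ s₀ ∈ A := hu ⟨hs0, hs0u'⟩
    have ht0B : γ t₀ ∈ B := hv ⟨ht0v', ht0⟩
    exact disjoint_left.1 hAB hs0A (heq ▸ ht0B)
  obtain ⟨K, -, hK⟩ := zorn_superset_nonempty S hchain univ huniv
  refine ⟨K, hK.1.1, hK.1.2.1, hK.1.2.2.1, fun s hs t ht hst ↦
    ⟨hK.1.2.2.2 s hs t ht hst, fun h ↦ ?_⟩⟩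
  have hmem : K \ Ioo s t ∈ S := by
    refine ⟨hK.1.1.sdiff isOpen_Ioo, ⟨hK.1.2.1, fun h ↦ ?_⟩, ⟨hK.1.2.2.1, fun h ↦ ?_⟩,
      fun s' hs' t' ht' hst' hd ↦ ?_⟩
    · exact not_lt_bot h.1
    · exact not_top_lt h.2
    · by_cases hd' : Disjoint (Ioo s' t') K
      · exact hK.1.2.2.2 s' hs'.1 t' ht'.1 hst' hd'
      · obtain ⟨w, hw, hwK⟩ := not_disjoint_iff.1 hd'
        have hwst : w ∈ Ioo s t := by
          by_contra hn
          exact disjoint_left.1 hd hw ⟨hwK, hn⟩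
        have h1 : s' = s := le_antisymm
          (not_lt.1 fun hlt ↦ hs'.2 ⟨hlt, hw.1.trans hwst.2⟩)
          (not_lt.1 fun hlt ↦ disjoint_left.1 hd ⟨hlt, hwst.1.trans hw.2⟩
            ⟨hs, fun h ↦ h.1.false⟩)
        have h2 : t' = t := le_antisymm
          (not_lt.1 fun hlt ↦ disjoint_left.1 hd ⟨hw.1.trans hwst.2, hlt⟩
            ⟨ht, fun h ↦ h.2.false⟩)
          (not_lt.1 fun hlt ↦ ht'.2 ⟨hwst.1.trans hw.2, hlt⟩)
        rw [h1, h2, h]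
  exact disjoint_left.2 fun w hw hwK ↦ (hK.2 hmem sdiff_subset hwK).2 hw

/-- A path in a metric space contains a path whose fibers are intervals. -/
theorem exists_continuous_monotone_path {X : Type*} [MetricSpace X]
    {γ : unitInterval → X} (hγ : Continuous γ) :
    ∃ g : unitInterval → X, Continuous g ∧ g 0 = γ 0 ∧ g 1 = γ 1 ∧ range g ⊆ range γ ∧
      ∀ s u t, s ≤ u → u ≤ t → g s = g t → g s = g u := by
  obtain ⟨K, hKcl, hK0, hK1, hK⟩ := exists_isClosed_forall_gap hγ
  have hl : ∀ t, ∃ l, IsGreatest (K ∩ Iic t) l := fun t ↦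
    (hKcl.inter isClosed_Iic).isCompact.exists_isGreatest ⟨0, hK0, unitInterval.nonneg'⟩
  have hr : ∀ t, ∃ r, IsLeast (K ∩ Ici t) r := fun t ↦
    (hKcl.inter isClosed_Ici).isCompact.exists_isLeast ⟨1, hK1, unitInterval.le_one'⟩
  choose l hl using hl
  choose r hr using hr
  have hlr : ∀ t, γ (l t) = γ (r t) := fun t ↦ by
    have h1 : l t ≤ t := (hl t).1.2
    have h2 : t ≤ r t := (hr t).1.2
    rcases (h1.trans h2).eq_or_lt with h | h
    · rw [h]
    · refine (hK _ (hl t).1.1 _ (hr t).1.1 h).1 (disjoint_left.2 fun w hw hwK ↦ ?_)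
      rcases le_total w t with h' | h'
      · exact ((hl t).2 ⟨hwK, h'⟩).not_gt hw.1
      · exact ((hr t).2 ⟨hwK, h'⟩).not_gt hw.2
  have hlK : ∀ t ∈ K, l t = t := fun t ht ↦ le_antisymm (hl t).1.2 ((hl t).2 ⟨ht, le_refl t⟩)
  refine ⟨γ ∘ l, continuous_iff_continuousAt.2 fun t ↦ ?_, by simp [hlK 0 hK0],
    by simp [hlK 1 hK1], range_comp_subset_range _ _, fun s u t hsu hut hst ↦ ?_⟩
  · by_cases ht : t ∈ K
    · rw [Metric.continuousAt_iff]
      intro ε hε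
      obtain ⟨δ, hδ, hd⟩ := Metric.continuousAt_iff.1 hγ.continuousAt ε hε
      refine ⟨δ, hδ, fun t' ht' ↦ ?_⟩
      rw [Function.comp_apply, Function.comp_apply, hlK t ht]
      rcases le_total t t' with h | h
      · refine hd (lt_of_le_of_lt ?_ ht')
        have h1 : t ≤ l t' := (hl t').2 ⟨ht, h⟩
        have h2 : l t' ≤ t' := (hl t').1.2
        rw [Subtype.dist_eq, Subtype.dist_eq, Real.dist_eq, Real.dist_eq]
        have h1' : (t : ℝ) ≤ l t' := h1
        have h2' : (l t' : ℝ) ≤ t' := h2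
        rw [abs_of_nonneg (by linarith), abs_of_nonneg (by linarith)]
        linarith
      · rw [hlr]
        refine hd (lt_of_le_of_lt ?_ ht')
        have h1 : r t' ≤ t := (hr t').2 ⟨ht, h⟩
        have h2 : t' ≤ r t' := (hr t').1.2
        rw [Subtype.dist_eq, Subtype.dist_eq, Real.dist_eq, Real.dist_eq]
        have h1' : (r t' : ℝ) ≤ t := h1
        have h2' : (t' : ℝ) ≤ r t' := h2
        rw [abs_of_nonpos (by linarith), abs_of_nonpos (by linarith)]
        linarith
    · have h1 : l t < t := (hl t).1.2.lt_of_ne fun h ↦ ht (h ▸ (hl t).1.1)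
      have h2 : t < r t := lt_of_le_of_ne (hr t).1.2 fun h ↦ ht (h ▸ (hr t).1.1)
      refine continuousAt_const.congr (f := fun _ ↦ γ (l t)) ?_
      filter_upwards [Ioo_mem_nhds h1 h2] with t' ht'
      have h3 : l t' = l t := by
        refine le_antisymm ?_ ((hl t').2 ⟨(hl t).1.1, ht'.1.le⟩)
        rcases le_total (l t') t with h | h
        · exact (hl t).2 ⟨(hl t').1.1, h⟩
        · exact absurd ((hr t).2 ⟨(hl t').1.1, h⟩)
            (not_le.2 (lt_of_le_of_lt (hl t').1.2 ht'.2))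
      rw [Function.comp_apply, h3]
  · have h1 : l s ≤ l u := (hl u).2 ⟨(hl s).1.1, (hl s).1.2.trans hsu⟩
    have h2 : l u ≤ l t := (hl t).2 ⟨(hl u).1.1, (hl u).1.2.trans hut⟩
    change γ (l s) = γ (l t) at hst
    change γ (l s) = γ (l u)
    rcases h1.eq_or_lt with h | h1
    · rw [h]
    rcases h2.eq_or_lt with h | h2
    · rw [h, hst]
    · exact absurd (hl u).1.1 (disjoint_left.1
        ((hK _ (hl s).1.1 _ (hl t).1.1 (h1.trans h2)).2 hst) ⟨h1, h2⟩)

/-- A path between distinct points of a compact metric space contains an injective one. -/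
theorem exists_injective_path {X : Type*} [MetricSpace X] [CompactSpace X]
    {γ : unitInterval → X} (hγ : Continuous γ) (hne : γ 0 ≠ γ 1) :
    ∃ δ : unitInterval → X, Continuous δ ∧ Function.Injective δ ∧ δ 0 = γ 0 ∧ δ 1 = γ 1 ∧
      range δ ⊆ range γ := by
  obtain ⟨g, hg, hg0, hg1, hgr, hmono⟩ := exists_continuous_monotone_path hγ
  have : Nonempty X := ⟨g 0⟩
  let B : unitInterval → Set X := fun t ↦ g '' Iic t
  have hBmem : ∀ {s t}, s ≤ t → g s ∈ B t := fun h ↦ mem_image_of_mem g h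
  obtain ⟨μ, hμ, hμB⟩ := exists_continuous_strictMono_size B (fun t ↦ ⟨g t, hBmem le_rfl⟩)
    (fun t ↦ (isClosed_Iic.isCompact.image hg).isClosed) (fun t ε hε ↦ by
      obtain ⟨δ, hδ, hd⟩ := Metric.continuousAt_iff.1 (hg.continuousAt (x := t)) (ε / 2)
        (half_pos hε)
      filter_upwards [Metric.ball_mem_nhds t hδ] with t' ht'
      have hball : ∀ s, s ∈ uIcc t' t → dist (g s) (g t) < ε / 2 := fun s hs ↦
        hd ((Real.dist_le_of_mem_uIcc
          (by simpa [uIcc, Icc] using hs) right_mem_uIcc).trans_lt ht')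
      constructor
      · rintro _ ⟨s, hs, rfl⟩
        rcases le_total s t' with h | h
        · exact ⟨g s, hBmem h, by simpa using hε.le⟩
        · refine ⟨g t', hBmem le_rfl, ?_⟩
          have h1 := hball s (mem_uIcc_of_le h hs)
          have h2 := hball t' left_mem_uIcc
          linarith [dist_triangle_right (g s) (g t') (g t)]
      · rintro _ ⟨s, hs, rfl⟩
        rcases le_total s t with h | h
        · exact ⟨g s, hBmem h, by simpa using hε.le⟩
        · exact ⟨g t, hBmem le_rfl, by linarith [hball s (mem_uIcc_of_ge h hs)]⟩)
  have hμmono : Monotone μ := fun s t hst ↦ (hμB s t (image_mono (Iic_subset_Iic.2 hst))).1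
  have hμeq : ∀ s t, s ≤ t → (μ s = μ t ↔ g s = g t) := by
    intro s t hst
    constructor
    · intro h
      obtain ⟨u, hu, hut⟩ := (hμB s t (image_mono (Iic_subset_Iic.2 hst))).2 h.ge (hBmem le_rfl)
      rw [← hut, hmono u s t hu hst hut]
    · intro h
      refine le_antisymm (hμmono hst) (hμB t s ?_).1
      rintro _ ⟨u, hu, rfl⟩
      rcases le_total u s with h' | h'
      · exact hBmem h'
      · rw [← hmono s u t h' hu h]
        exact hBmem le_rfl
  have hμeq' : ∀ s t, μ s = μ t ↔ g s = g t := fun s t ↦ by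
    rcases le_total s t with h | h
    · exact hμeq s t h
    · rw [eq_comm, hμeq t s h, eq_comm]
  have hlt : μ 0 < μ 1 := (hμmono unitInterval.nonneg').lt_of_ne fun h ↦ hne (by
    rw [← hg0, ← hg1, (hμeq' 0 1).1 h])
  have hpos : 0 < μ 1 - μ 0 := sub_pos.2 hlt
  let Φ : unitInterval → unitInterval := fun t ↦ ⟨(μ t - μ 0) / (μ 1 - μ 0),
    div_nonneg (sub_nonneg.2 (hμmono unitInterval.nonneg')) hpos.le,
    (div_le_one hpos).2 (sub_le_sub_right (hμmono unitInterval.le_one') _)⟩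
  have hΦ : Continuous Φ := by fun_prop
  have hΦ0 : Φ 0 = 0 := Subtype.ext (by simp [Φ])
  have hΦ1 : Φ 1 = 1 := Subtype.ext (by simp [Φ, hpos.ne'])
  have hΦeq : ∀ s t, Φ s = Φ t ↔ g s = g t := fun s t ↦ by
    rw [← hμeq' s t, Subtype.ext_iff]
    simp [Φ, div_left_inj' hpos.ne']
  have hsurj : Function.Surjective Φ := fun y ↦
    mem_range_of_exists_le_of_exists_ge hΦ ⟨0, hΦ0.trans_le unitInterval.nonneg'⟩
      ⟨1, unitInterval.le_one'.trans_eq hΦ1.symm⟩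
  have hquot : IsQuotientMap Φ := hΦ.isClosedMap.isQuotientMap hΦ hsurj
  choose σ hσ using hsurj
  have hgσ : ∀ t, g (σ (Φ t)) = g t := fun t ↦ (hΦeq _ _).1 (hσ _)
  refine ⟨g ∘ σ, hquot.continuous_iff.2 ?_, fun s t hst ↦ ?_, ?_, ?_, ?_⟩
  · exact hg.congr fun t ↦ (hgσ t).symm
  · rw [← hσ s, ← hσ t]
    exact (hΦeq _ _).2 hst
  · rw [← hg0, ← hgσ 0, hΦ0, Function.comp_apply]
  · rw [← hg1, ← hgσ 1, hΦ1, Function.comp_apply]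
  · exact (range_comp_subset_range _ _).trans hgr

/-- Two arcs with the same endpoints and otherwise disjoint form a simple closed curve. -/
theorem exists_isSimpleClosedCurve_of_arcs {X : Type*} [TopologicalSpace X] [T2Space X]
    {α δ : unitInterval → X} (hα : Continuous α) (hδ : Continuous δ)
    (hαi : Function.Injective α) (hδi : Function.Injective δ) (h10 : α 1 = δ 0) (h01 : δ 1 = α 0)
    (hαδ : ∀ s t, α s = δ t → s = 1 ∧ t = 0 ∨ s = 0 ∧ t = 1) :
    ∃ S : Set X, IsSimpleClosedCurve S ∧ range α ⊆ S := by
  let f : ℝ → X := fun t ↦ if t ≤ 1 / 2 then IccExtend zero_le_one α (2 * t)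
    else IccExtend zero_le_one δ (2 * t - 1)
  have hf : Continuous f := by
    refine Continuous.if_le (hα.Icc_extend'.comp (by fun_prop))
      (hδ.Icc_extend'.comp (by fun_prop)) continuous_id continuous_const fun t ht ↦ ?_
    subst ht
    norm_num
    exact h10
  have hfα : ∀ t : ℝ, ∀ h : 2 * t ∈ Icc (0 : ℝ) 1, f t = α ⟨2 * t, h⟩ := fun t h ↦ by
    rw [← IccExtend_of_mem zero_le_one α h]
    exact if_pos (by linarith [h.2])
  have hfδ : ∀ t : ℝ, 1 / 2 < t → ∀ h : 2 * t - 1 ∈ Icc (0 : ℝ) 1, f t = δ ⟨2 * t - 1, h⟩ :=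
    fun t ht h ↦ by
      rw [← IccExtend_of_mem zero_le_one δ h]
      exact if_neg (not_le.2 ht)
  have hinj : InjOn f (Ico 0 1) := by
    have hcross : ∀ s ∈ Ico (0 : ℝ) 1, ∀ t ∈ Ico (0 : ℝ) 1, s ≤ 1 / 2 → 1 / 2 < t →
        f s ≠ f t := by
      intro s hs t ht hs' ht' h
      rw [hfα s ⟨by linarith [hs.1], by linarith⟩,
        hfδ t ht' ⟨by linarith, by linarith [ht.2]⟩] at h
      rcases hαδ _ _ h with h | h
      · have := congrArg Subtype.val h.2
        simp only [Icc.coe_zero] at this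
        linarith
      · have := congrArg Subtype.val h.2
        simp only [Icc.coe_one] at this
        linarith [ht.2]
    intro s hs t ht h
    rcases le_or_gt s (1 / 2) with hs' | hs' <;> rcases le_or_gt t (1 / 2) with ht' | ht'
    · rw [hfα s ⟨by linarith [hs.1], by linarith⟩, hfα t ⟨by linarith [ht.1], by linarith⟩] at h
      have := congrArg Subtype.val (hαi h)
      simp only at this
      linarith
    · exact absurd h (hcross s hs t ht hs' ht')
    · exact absurd h.symm (hcross t ht s hs ht' hs')
    · rw [hfδ s hs' ⟨by linarith, by linarith [hs.2]⟩,
        hfδ t ht' ⟨by linarith, by linarith [ht.2]⟩] at h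
      have := congrArg Subtype.val (hδi h)
      simp only at this
      linarith
  have : Fact ((0 : ℝ) < 1) := ⟨one_pos⟩
  have hf01 : f 0 = f (0 + 1) := by
    rw [hfα 0 (by norm_num), hfδ (0 + 1) (by norm_num) (by norm_num)]
    convert h01.symm using 2 <;> ext <;> norm_num
  have hF : Continuous (AddCircle.liftIco 1 0 f) := AddCircle.liftIco_continuous hf01 hf.continuousOn
  have hFi : Function.Injective (AddCircle.liftIco 1 0 f) := fun x y hxy ↦
    (AddCircle.equivIco 1 0).injective (Subtype.ext (hinj
      (by simpa using (AddCircle.equivIco 1 0 x).2) (by simpa using (AddCircle.equivIco 1 0 y).2)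
      hxy))
  refine ⟨range (AddCircle.liftIco 1 0 f),
    ⟨(hF.isClosedEmbedding hFi).isEmbedding.toHomeomorph.symm⟩, ?_⟩
  rintro _ ⟨s, rfl⟩
  refine ⟨((s / 2 : ℝ) : AddCircle (1 : ℝ)), ?_⟩
  have hs := s.2
  rw [AddCircle.liftIco_coe_apply ⟨by linarith [hs.1], by linarith [hs.2]⟩,
    hfα _ ⟨by linarith [hs.1], by linarith [hs.2]⟩]
  congr 1
  ext
  simp only
  ring

/-- If removing an interior point of an arc does not separate its endpoints, then this point lies
on a simple closed curve. -/
theorem exists_isSimpleClosedCurve_mem {X : Type*} [MetricSpace X] [CompactSpace X]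
    [LocallyConnectedSpace X] {α : unitInterval → X} (hα : Continuous α)
    (hαi : Function.Injective α) {s : unitInterval} {V : Set X} (hV : IsPreconnected V)
    (h0 : α 0 ∈ V) (h1 : α 1 ∈ V) (hs : α s ∉ V) :
    ∃ S : Set X, IsSimpleClosedCurve S ∧ α s ∈ S := by
  have hVsub : V ⊆ connectedComponentIn {α s}ᶜ (α 0) :=
    hV.subset_connectedComponentIn h0 (subset_compl_singleton_iff.2 hs)
  obtain ⟨β, hβ⟩ := isPreconnected_connectedComponentIn.joinedIn_of_isOpen
    isOpen_compl_singleton.connectedComponentIn (hVsub h0) (hVsub h1)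
  have hsB : α s ∉ range β := by
    rintro ⟨t, ht⟩
    exact connectedComponentIn_subset _ _ (hβ t) ht
  have hcl : IsClosed (α ⁻¹' range β) := (isCompact_range β.continuous).isClosed.preimage hα
  obtain ⟨s₁, ⟨hs₁B, hs₁⟩, hs₁'⟩ := (hcl.inter (isClosed_Iic (a := s))).isCompact.exists_isGreatest
    ⟨0, ⟨0, β.source⟩, unitInterval.nonneg'⟩
  obtain ⟨s₂, ⟨hs₂B, hs₂⟩, hs₂'⟩ := (hcl.inter (isClosed_Ici (a := s))).isCompact.exists_isLeast
    ⟨1, ⟨1, β.target⟩, unitInterval.le_one'⟩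
  have hlt₁ : s₁ < s := lt_of_le_of_ne hs₁ fun h ↦ hsB (h ▸ hs₁B)
  have hlt₂ : s < s₂ := lt_of_le_of_ne hs₂ fun h ↦ hsB (h ▸ hs₂B)
  have hlt := hlt₁.trans hlt₂
  have : PathConnectedSpace unitInterval := isPathConnected_iff_pathConnectedSpace.1
    ((convex_Icc (0 : ℝ) 1).isPathConnected ⟨0, by simp⟩)
  obtain ⟨γ, hγ⟩ := (isPathConnected_range β.continuous).joinedIn _ hs₂B _ hs₁B
  obtain ⟨δ, hδ, hδi, hδ0, hδ1, hδr⟩ := exists_injective_path γ.continuous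
    (by simpa using fun h ↦ hlt.ne' (hαi h))
  rw [γ.source] at hδ0
  rw [γ.target] at hδ1
  have hδB : ∀ t, δ t ∈ range β := fun t ↦ by
    obtain ⟨u, hu⟩ := hδr ⟨t, rfl⟩
    exact hu ▸ hγ u
  have hltR : (s₁ : ℝ) < s₂ := hlt
  let φ : unitInterval → unitInterval := fun u ↦ ⟨(1 - u) * s₁ + u * s₂, by
    have := u.2.1; have := u.2.2; have := s₁.2.1; have := s₂.2.2
    constructor <;> nlinarith⟩
  have hφ : Continuous φ := by fun_prop
  have hφmem : ∀ u, φ u ∈ Icc s₁ s₂ := fun u ↦ by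
    have := u.2.1; have := u.2.2
    constructor
    · change (s₁ : ℝ) ≤ (1 - u) * s₁ + u * s₂
      nlinarith
    · change (1 - u) * s₁ + u * s₂ ≤ (s₂ : ℝ)
      nlinarith
  have hφi : Function.Injective φ := fun u v h ↦ by
    have h' : (1 - u) * s₁ + u * s₂ = ((1 - v) * s₁ + v * s₂ : ℝ) := congrArg Subtype.val h
    have : ((u : ℝ) - v) * (s₂ - s₁) = 0 := by linarith
    rcases mul_eq_zero.1 this with h | h
    · exact Subtype.ext (sub_eq_zero.1 h)
    · linarith
  have hφ0 : φ 0 = s₁ := Subtype.ext (by simp [φ])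
  have hφ1 : φ 1 = s₂ := Subtype.ext (by simp [φ])
  obtain ⟨S, hS, hαS⟩ := exists_isSimpleClosedCurve_of_arcs (hα.comp hφ) hδ (hαi.comp hφi) hδi
    (by simp [hφ1, hδ0]) (by simp [hφ0, hδ1]) (fun u v huv ↦ by
      have hB : α (φ u) ∈ range β := by
        change α (φ u) = δ v at huv
        exact huv ▸ hδB v
      rcases le_total (φ u) s with h | h
      · have h' : φ u = s₁ := le_antisymm (hs₁' ⟨hB, h⟩) (hφmem u).1
        refine .inr ⟨hφi (h'.trans hφ0.symm), hδi ?_⟩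
        rw [← huv, Function.comp_apply, h', hδ1]
      · have h' : φ u = s₂ := le_antisymm (hφmem u).2 (hs₂' ⟨hB, h⟩)
        refine .inl ⟨hφi (h'.trans hφ1.symm), hδi ?_⟩
        rw [← huv, Function.comp_apply, h', hδ0])
  obtain ⟨u, hu⟩ : s ∈ range φ := mem_range_of_exists_le_of_exists_ge hφ ⟨0, hφ0.trans_le hs₁⟩
    ⟨1, hs₂.trans_eq hφ1.symm⟩
  exact ⟨S, hS, hαS ⟨u, congrArg α hu⟩⟩

/-- The points which lie in every compact connected set joining `x` to `G`. -/
def pathToward {X : Type*} [TopologicalSpace X] (G : Set X) (x : X) : Set X :=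
  {y | ∀ K : Set X, IsCompact K → IsPreconnected K → x ∈ K → (K ∩ G).Nonempty → y ∈ K}

section PathToward

variable {X : Type*} [TopologicalSpace X] {G : Set X} {x y z : X}

theorem self_mem_pathToward : x ∈ pathToward G x := fun _ _ _ hx _ ↦ hx

theorem pathToward_subset_of_mem (hy : y ∈ pathToward G x) : pathToward G y ⊆ pathToward G x :=
  fun _ hz K hK hKc hx hKG ↦ hz K hK hKc (hy K hK hKc hx hKG) hKG

theorem isClosed_pathToward [T2Space X] : IsClosed (pathToward G x) := by
  simp only [pathToward, ofPred_forall]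
  exact isClosed_iInter fun K ↦ isClosed_iInter fun hK ↦ isClosed_iInter fun _ ↦
    isClosed_iInter fun _ ↦ isClosed_iInter fun _ ↦ hK.isClosed

theorem eq_of_mem_pathToward_of_mem (hx : x ∈ G) (hy : y ∈ pathToward G x) : y = x :=
  hy {x} isCompact_singleton isPreconnected_singleton rfl ⟨x, rfl, hx⟩

theorem mem_pathToward_or_mem_closure [CompactSpace X] {W : Set X} (hW : IsPreconnected W)
    (hx : x ∈ W) (hz : z ∈ W) (hy : y ∈ pathToward G x) : y ∈ pathToward G z ∨ y ∈ closure W := by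
  by_cases hyW : y ∈ closure W
  · exact .inr hyW
  refine .inl fun K hK hKc hzK hKG ↦ ?_
  refine (hy (K ∪ closure W) (hK.union isClosed_closure.isCompact)
    (hKc.union z hzK (subset_closure hz) hW.closure) (.inr (subset_closure hx))
    (hKG.mono (inter_subset_inter_left _ subset_union_left))).resolve_right hyW

end PathToward

theorem exists_isPreconnected_mem_nhds {X : Type*} [MetricSpace X]
    [LocallyConnectedSpace X] (x : X) {ε : ℝ} (hε : 0 < ε) :
    ∃ W ∈ 𝓝 x, IsPreconnected W ∧ x ∈ W ∧ closure W ⊆ Metric.closedBall x ε := by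
  obtain ⟨W, hW, hWc, hWε⟩ := locallyConnectedSpace_iff_connected_subsets.1
    ‹LocallyConnectedSpace X› x _ (Metric.ball_mem_nhds x hε)
  exact ⟨W, hW, hWc, mem_of_mem_nhds hW,
    closure_minimal (hWε.trans Metric.ball_subset_closedBall) Metric.isClosed_closedBall⟩

section Retraction

variable {X : Type*} [MetricSpace X] [CompactSpace X] [LocallyConnectedSpace X] {G : Set X}
  {x y z : X}

theorem isClosed_setOf_mem_pathToward : IsClosed {p : X × X | p.2 ∈ pathToward G p.1} := by
  rw [← isOpen_compl_iff, isOpen_iff_mem_nhds]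
  rintro ⟨x, y⟩ hxy
  have hne : x ≠ y := by
    rintro rfl
    exact hxy self_mem_pathToward
  have hd : 0 < dist x y / 2 := by simpa using hne
  obtain ⟨W, hW, hWc, hxW, hWε⟩ := exists_isPreconnected_mem_nhds x hd
  have hyW : y ∉ closure W := fun h ↦ by
    have := hWε h
    rw [Metric.mem_closedBall, dist_comm] at this
    linarith
  have hV : (pathToward G x ∪ closure W)ᶜ ∈ 𝓝 y :=
    (isClosed_pathToward.union isClosed_closure).isOpen_compl.mem_nhds
      (by simpa [hyW] using hxy)
  filter_upwards [prod_mem_nhds hW hV] with p hp hp'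
  exact hp.2 (mem_pathToward_or_mem_closure hWc hp.1 hxW hp')

/-- If `G` contains all simple closed curves and `x ∉ G`, then `pathToward G x` is an arc. -/
theorem exists_arc_pathToward [ConnectedSpace X] (hGc : IsClosed G) (hG : IsPreconnected G)
    (hne : G.Nonempty)
    (hS : ∀ S : Set X, IsSimpleClosedCurve S → S ⊆ G) (hx : x ∉ G) :
    ∃ α : unitInterval → X, Continuous α ∧ Function.Injective α ∧ α 0 = x ∧ α 1 ∈ G ∧
      (∀ s t, s ≤ t → α t ∈ pathToward G (α s)) ∧ ∀ s, pathToward G (α s) ⊆ α '' Ici s := by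
  obtain ⟨g, hg⟩ := hne
  obtain ⟨γ, -⟩ := (isPreconnected_univ (α := X)).joinedIn_of_isOpen isOpen_univ (mem_univ x)
    (mem_univ g)
  obtain ⟨δ, hδ, hδi, hδ0, hδ1, -⟩ := exists_injective_path γ.continuous
    (by simpa using fun h : x = g ↦ hx (h ▸ hg))
  rw [γ.source] at hδ0
  rw [γ.target] at hδ1
  obtain ⟨s₀, hs₀G, hs₀⟩ := (hGc.preimage hδ).isCompact.exists_isLeast ⟨1, by simpa [hδ1] using hg⟩
  have hs₀0 : s₀ ≠ 0 := by
    rintro rfl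
    exact hx (hδ0 ▸ hs₀G)
  let α : unitInterval → X := fun u ↦ δ (u * s₀)
  have hα : Continuous α := by fun_prop
  have hαi : Function.Injective α := fun u v h ↦ by
    have := congrArg Subtype.val (hδi h)
    simp only [Icc.coe_mul] at this
    exact Subtype.ext (mul_right_cancel₀ (by simpa using hs₀0) this)
  have hα1 : α 1 ∈ G := by simpa [α] using hs₀G
  have hαG : ∀ s, α s ∈ G → s = 1 := fun s hs ↦ by
    have h1 : (s₀ : ℝ) ≤ s * s₀ := hs₀ hs
    have h2 : (0 : ℝ) < s₀ := lt_of_le_of_ne s₀.2.1 (by simpa [eq_comm] using hs₀0)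
    exact le_antisymm unitInterval.le_one' (show (1 : ℝ) ≤ s by nlinarith)
  have hIci : ∀ s : unitInterval, IsPreconnected (Ici s) := fun s ↦ ordConnected_Ici.isPreconnected
  have key : ∀ s t, s ≤ t → t ≠ 1 → α t ∈ pathToward G (α s) := by
    intro s t hst ht K hK hKc hsK hKG
    by_contra htK
    have hst' : s < t := lt_of_le_of_ne hst fun h ↦ htK (h ▸ hsK)
    obtain ⟨k, hkK, hkG⟩ := hKG
    have hV : IsPreconnected (α '' Iic s ∪ (K ∪ G)) :=
      (ordConnected_Iic.isPreconnected.image α hα.continuousOn).union (α s)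
        (mem_image_of_mem α (mem_Iic.2 le_rfl)) (.inl hsK) (hKc.union k hkK hkG hG)
    obtain ⟨S, hSc, htS⟩ := exists_isSimpleClosedCurve_mem hα hαi (s := t) hV
      (.inl ⟨0, unitInterval.nonneg', rfl⟩) (.inr (.inr hα1)) (by
        rintro (⟨u, hu, hut⟩ | h | h)
        · exact (hst'.trans_le ((hαi hut).ge.trans hu)).false
        · exact htK h
        · exact ht (hαG t h))
    exact ht (hαG t (hS S hSc htS))
  refine ⟨α, hα, hαi, by simpa [α] using hδ0, hα1, fun s t hst ↦ ?_, fun s y hy ↦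
    hy _ (isClosed_Ici.isCompact.image hα) ((hIci s).image α hα.continuousOn)
      (mem_image_of_mem α (mem_Ici.2 le_rfl))
      ⟨α 1, mem_image_of_mem α unitInterval.le_one', hα1⟩⟩
  by_cases ht : t = 1
  · subst ht
    rcases hst.eq_or_lt with rfl | hs
    · exact self_mem_pathToward
    have hcl : IsClosed (α ⁻¹' pathToward G (α s)) := isClosed_pathToward.preimage hα
    have : closure (Ico s 1) ⊆ α ⁻¹' pathToward G (α s) :=
      hcl.closure_subset_iff.2 fun u hu ↦ key s u hu.1 hu.2.ne
    rw [closure_Ico hs.ne] at this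
    exact this ⟨hs.le, le_rfl⟩
  · exact key s t hst ht

/-- If `G` contains all simple closed curves, then `pathToward G x` is connected, meets `G`, and is
linearly ordered by the relation `z ∈ pathToward G y`. -/
theorem pathToward_chain [ConnectedSpace X] (hGc : IsClosed G) (hG : IsPreconnected G)
    (hne : G.Nonempty) (hS : ∀ S : Set X, IsSimpleClosedCurve S → S ⊆ G) (x : X) :
    IsPreconnected (pathToward G x) ∧ (pathToward G x ∩ G).Nonempty ∧
      (∀ y ∈ pathToward G x, ∀ z ∈ pathToward G x, z ∈ pathToward G y ∨ y ∈ pathToward G z) ∧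
      ∀ y ∈ pathToward G x, x ∈ pathToward G y → y = x := by
  by_cases hx : x ∈ G
  · have : pathToward G x = {x} := subset_antisymm (fun y hy ↦ eq_of_mem_pathToward_of_mem hx hy)
      (singleton_subset_iff.2 self_mem_pathToward)
    rw [this]
    refine ⟨isPreconnected_singleton, ⟨x, rfl, hx⟩, ?_, fun y hy _ ↦ hy⟩
    rintro _ rfl _ rfl
    exact .inl self_mem_pathToward
  obtain ⟨α, hα, hαi, rfl, hα1, hle, hsub⟩ := exists_arc_pathToward hGc hG hne hS hx
  have hr : pathToward G (α 0) = range α := by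
    refine subset_antisymm ((hsub 0).trans (image_subset_range _ _)) ?_
    rintro _ ⟨t, rfl⟩
    exact hle 0 t unitInterval.nonneg'
  rw [hr]
  refine ⟨isPreconnected_range hα, ⟨α 1, ⟨1, rfl⟩, hα1⟩, ?_, ?_⟩
  · rintro _ ⟨s, rfl⟩ _ ⟨t, rfl⟩
    exact (le_total s t).imp (hle s t) (hle t s)
  · rintro _ ⟨s, rfl⟩ h
    obtain ⟨t, ht, hts⟩ := hsub s h
    rw [hαi hts] at ht
    exact congrArg α (le_antisymm ht unitInterval.nonneg')

/-- A height function which vanishes on `G` and is injective along the paths toward `G`. -/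
theorem exists_height_pathToward [ConnectedSpace X] (hGc : IsClosed G) (hG : IsPreconnected G)
    (hne : G.Nonempty) (hS : ∀ S : Set X, IsSimpleClosedCurve S → S ⊆ G) :
    ∃ μ : X → ℝ, Continuous μ ∧ (∀ x, 0 ≤ μ x) ∧ (∀ x, μ x = 0 ↔ x ∈ G) ∧
      ∀ x, ∀ y ∈ pathToward G x, μ y = μ x → y = x := by
  have hB : ∀ x, G ⊆ G ∪ pathToward G x := fun x ↦ subset_union_left
  obtain ⟨μ, hμ, hμB⟩ := exists_continuous_strictMono_size (fun x ↦ G ∪ pathToward G x)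
    (fun x ↦ hne.mono (hB x)) (fun x ↦ hGc.union isClosed_pathToward) (by
      intro x ε hε
      obtain ⟨W, hW, hWc, hxW, hWε⟩ := exists_isPreconnected_mem_nhds x (half_pos hε)
      have hd : ∀ u ∈ closure W, ∀ v ∈ W, dist u v ≤ ε := fun u hu v hv ↦ by
        have h1 := hWε hu
        have h2 := hWε (subset_closure hv)
        rw [Metric.mem_closedBall] at h1 h2
        linarith [dist_triangle_right u v x]
      have key : ∀ u ∈ W, ∀ v ∈ W, ∀ y ∈ G ∪ pathToward G u,
          ∃ y' ∈ G ∪ pathToward G v, dist y y' ≤ ε := by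
        rintro u hu v hv y (hy | hy)
        · exact ⟨y, .inl hy, by simpa using hε.le⟩
        · rcases mem_pathToward_or_mem_closure hWc hu hv hy with h | h
          · exact ⟨y, .inr h, by simpa using hε.le⟩
          · exact ⟨v, .inr self_mem_pathToward, hd y h v hv⟩
      filter_upwards [hW] with x' hx'
      exact ⟨key x hxW x' hx', key x' hx' x hxW⟩)
  obtain ⟨g, hg⟩ := hne
  have hBG : ∀ x ∈ G, G ∪ pathToward G x = G := fun x hx ↦
    union_eq_left.2 fun y hy ↦ (eq_of_mem_pathToward_of_mem hx hy).symm ▸ hx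
  have hgx : ∀ x, μ g ≤ μ x ∧ (μ x ≤ μ g → G ∪ pathToward G x ⊆ G) := fun x ↦ by
    have := hμB g x
    simp only [hBG g hg] at this
    exact this (hB x)
  refine ⟨fun x ↦ μ x - μ g, by fun_prop, fun x ↦ sub_nonneg.2 (hgx x).1, fun x ↦
    ⟨fun h ↦ (hgx x).2 (sub_eq_zero.1 h).le (.inr self_mem_pathToward), fun hx ↦ ?_⟩,
    fun x y hy h ↦ ?_⟩
  · refine sub_eq_zero.2 (le_antisymm ((hμB x g ?_).1) (hgx x).1)
    simp only [hBG x hx]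
    exact hB g
  · rcases (hμB y x (union_subset_union_right _ (pathToward_subset_of_mem hy))).2
      (sub_left_inj.1 h).ge (.inr self_mem_pathToward) with hx | hx
    · exact eq_of_mem_pathToward_of_mem hx hy
    · exact (pathToward_chain hGc hG ⟨g, hg⟩ hS x).2.2.2 y hy hx

theorem continuous_of_isClosed_graph {Y Z : Type*} [TopologicalSpace Y] [TopologicalSpace Z]
    [CompactSpace Z] {f : Y → Z} (hf : IsClosed {p : Y × Z | p.2 = f p.1}) : Continuous f := by
  refine continuous_iff_isClosed.2 fun C hC ↦ ?_
  convert isClosedMap_fst_of_compactSpace _ (hf.inter (hC.preimage continuous_snd)) using 1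
  ext y
  simp

/-- A subcontinuum of a locally connected continuum which contains all simple closed curves is a
strong deformation retract. -/
theorem exists_strongDeformationRetraction [ConnectedSpace X] (hGc : IsClosed G)
    (hG : IsPreconnected G) (hne : G.Nonempty)
    (hS : ∀ S : Set X, IsSimpleClosedCurve S → S ⊆ G) :
    ∃ h : unitInterval × X → X, Continuous h ∧ (∀ x, h (0, x) = x) ∧ (∀ x, h (1, x) ∈ G) ∧
      ∀ t, ∀ g ∈ G, h (t, g) = g := by
  obtain ⟨μ, hμ, hμ0, hμG, hμi⟩ := exists_height_pathToward hGc hG hne hS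
  have hex : ∀ p : unitInterval × X, ∃ y ∈ pathToward G p.2, μ y = (1 - p.1) * μ p.2 := by
    rintro ⟨t, x⟩
    obtain ⟨hc, ⟨g, hgx, hg⟩, -⟩ := pathToward_chain hGc hG hne hS x
    refine hc.intermediate_value hgx self_mem_pathToward hμ.continuousOn ?_
    rw [(hμG g).2 hg]
    have := hμ0 x
    exact ⟨mul_nonneg (by linarith [t.2.2]) this, by nlinarith [t.2.1]⟩
  choose h hh hhμ using hex
  have huniq : ∀ p : unitInterval × X, ∀ y ∈ pathToward G p.2, μ y = (1 - p.1) * μ p.2 →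
      y = h p := by
    intro p y hy hyμ
    have hμe : μ y = μ (h p) := hyμ.trans (hhμ p).symm
    rcases (pathToward_chain hGc hG hne hS p.2).2.2.1 _ hy _ (hh p) with h' | h'
    · exact (hμi _ _ h' hμe.symm).symm
    · exact hμi _ _ h' hμe
  refine ⟨h, continuous_of_isClosed_graph ?_, fun x ↦ ?_, fun x ↦ ?_, fun t g hg ↦ ?_⟩
  · have : {p : (unitInterval × X) × X | p.2 = h p.1} =
        {p | p.2 ∈ pathToward G p.1.2} ∩ {p | μ p.2 = (1 - p.1.1) * μ p.1.2} := by
      ext p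
      refine ⟨fun hp ↦ ?_, fun hp ↦ huniq _ _ hp.1 hp.2⟩
      obtain ⟨p, y⟩ := p
      obtain rfl : y = h p := hp
      exact ⟨hh p, hhμ p⟩
    rw [this]
    exact (isClosed_setOf_mem_pathToward.preimage
      (f := fun p : (unitInterval × X) × X ↦ (p.1.2, p.2)) (by fun_prop)).inter
      (isClosed_eq (by fun_prop) (by fun_prop))
  · exact (huniq (0, x) x self_mem_pathToward (by simp)).symm
  · exact (hμG _).1 ((hhμ (1, x)).trans (by simp))
  · exact eq_of_mem_pathToward_of_mem hg (hh (t, g))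

end Retraction

/-- In the absence of simple closed curves, an interior point of an arc separates its endpoints:
some continuous function is locally constant away from this point and equals `0` and `1` there. -/
theorem exists_separating_function {X : Type*} [MetricSpace X] [CompactSpace X]
    [LocallyConnectedSpace X] (hX : ∀ S : Set X, ¬IsSimpleClosedCurve S) {α : unitInterval → X}
    (hα : Continuous α) (hαi : Function.Injective α) {s : unitInterval} {ρ : ℝ} (hρ : 0 < ρ)
    (h0 : ρ ≤ dist (α 0) (α s)) (h1 : ρ ≤ dist (α 1) (α s)) :
    ∃ u : X → ℝ, Continuous u ∧ u (α 0) = 0 ∧ u (α 1) = 1 ∧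
      ∀ x, ρ ≤ dist x (α s) → u x = 0 ∨ u x = 1 := by
  classical
  set c := α s with hc
  let P := connectedComponentIn {c}ᶜ (α 0)
  have hPo : IsOpen P := isOpen_compl_singleton.connectedComponentIn
  have hne : ∀ x, ρ ≤ dist x c → x ≠ c := by
    rintro x hx rfl
    rw [dist_self] at hx
    linarith
  have h0P : α 0 ∈ P := mem_connectedComponentIn (hne _ h0)
  have hcP : c ∉ P := fun h ↦ connectedComponentIn_subset _ _ h rfl
  have h1P : α 1 ∉ P := fun h ↦ by
    obtain ⟨S, hS, -⟩ := exists_isSimpleClosedCurve_mem hα hαi isPreconnected_connectedComponentIn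
      h0P h hcP
    exact hX S hS
  have hPc : closure P ⊆ insert c P := by
    intro x hx
    by_contra hxP
    rw [mem_insert_iff, not_or] at hxP
    have hopen : IsOpen (connectedComponentIn {c}ᶜ x) :=
      isOpen_compl_singleton.connectedComponentIn
    obtain ⟨y, hy, hyP⟩ := mem_closure_iff.1 hx _ hopen (mem_connectedComponentIn hxP.1)
    have := (connectedComponentIn_eq hy).trans (connectedComponentIn_eq hyP).symm
    exact hxP.2 (this.subset (mem_connectedComponentIn hxP.1))
  have hfr : frontier P ⊆ {c} := fun x hx ↦
    (hPc hx.1).resolve_right fun h ↦ hx.2 (hPo.interior_eq.symm ▸ h)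
  have hmin : ∀ x, ρ ≤ dist x c → min (1 / 2) (dist x c / (2 * ρ)) = 1 / 2 := fun x hx ↦
    min_eq_left (by rw [div_le_div_iff₀ two_pos (by positivity)]; linarith)
  refine ⟨fun x ↦ if x ∈ P then 1 / 2 - min (1 / 2) (dist x c / (2 * ρ)) else
    1 / 2 + min (1 / 2) (dist x c / (2 * ρ)), ?_, ?_, ?_, fun x hx ↦ ?_⟩
  · refine Continuous.if (fun x hx ↦ ?_) (by fun_prop) (by fun_prop)
    have : x = c := hfr hx
    subst this
    norm_num
  · simp only [if_pos h0P, hmin _ h0, sub_self]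
  · simp only [if_neg h1P, hmin _ h1]
    norm_num
  · simp only [hmin x hx]
    split_ifs <;> norm_num

/-- A circle-valued function which is homotopic to a constant through self-maps of its domain lifts
to a real-valued function. -/
theorem exists_lift_of_homotopy {X : Type*} [TopologicalSpace X] {h : unitInterval × X → X}
    (hh : Continuous h) (h0 : ∀ x, h (0, x) = x) {f : X → AddCircle (1 : ℝ)} (hf : Continuous f)
    (h1 : ∀ x, f (h (1, x)) = 0) :
    ∃ F : X → ℝ, Continuous F ∧ ∀ x, (F x : AddCircle (1 : ℝ)) = f x := by
  let H : C(unitInterval × X, AddCircle (1 : ℝ)) :=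
    ⟨fun p ↦ f (h (unitInterval.symm p.1, p.2)), by fun_prop⟩
  have H0 : ∀ x, H (0, x) = ((ContinuousMap.const X (0 : ℝ) x : ℝ) : AddCircle (1 : ℝ)) :=
    fun x ↦ by simp [H, h1]
  have cov := AddCircle.isCoveringMap_coe (1 : ℝ)
  refine ⟨fun x ↦ cov.liftHomotopy H _ H0 (1, x), by fun_prop, fun x ↦ ?_⟩
  refine (congrFun (cov.liftHomotopy_lifts H _ H0) (1, x)).trans ?_
  simp [H, h0]

theorem IsPreconnected.eq_of_coe_addCircle_eq_zero {Y : Type*} [TopologicalSpace Y] {s : Set Y}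
    (hs : IsPreconnected s) {g : Y → ℝ} (hg : ContinuousOn g s)
    (h : ∀ y ∈ s, (g y : AddCircle (1 : ℝ)) = 0) {y z : Y} (hy : y ∈ s) (hz : z ∈ s) :
    g y = g z := by
  have : IsDiscrete (AddSubgroup.zmultiples (1 : ℝ) : Set ℝ) :=
    ⟨inferInstanceAs (DiscreteTopology (AddSubgroup.zmultiples (1 : ℝ)))⟩
  exact hs.constant_of_mapsTo this hg
    (fun x hx ↦ (QuotientAddGroup.eq_zero_iff (g x)).1 (h x hx)) hy hz

theorem IsLocalDendrite.locallyConnectedSpace {X : Type*} [TopologicalSpace X]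
    (hX : IsLocalDendrite X) : LocallyConnectedSpace X := by
  refine locallyConnectedSpace_iff_connected_subsets.2 fun x U hU ↦ ?_
  obtain ⟨N, hN, -, hNl, -⟩ := hX.2 x
  obtain ⟨V, hV, hVc, hVU⟩ := locallyConnectedSpace_iff_connected_subsets.1 hNl
    ⟨x, mem_of_mem_nhds hN⟩ (Subtype.val ⁻¹' U) (continuous_subtype_val.continuousAt hU)
  refine ⟨Subtype.val '' V, ?_, hVc.image _ continuous_subtype_val.continuousOn,
    image_subset_iff.2 hVU⟩
  rw [← map_nhds_subtype_coe_eq_nhds (mem_of_mem_nhds hN) hN]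
  exact image_mem_map hV

/-- A simple closed curve has a periodic parametrization starting at a given point. -/
theorem IsSimpleClosedCurve.exists_periodic {X : Type*} [TopologicalSpace X] {S : Set X}
    (hS : IsSimpleClosedCurve S) {p : X} (hp : p ∈ S) :
    ∃ e : ℝ → X, Continuous e ∧ e 0 = p ∧ (∀ t, e (t + 1) = e t) ∧
      ∀ s t, |s - t| < 1 → e s = e t → s = t := by
  obtain ⟨φ⟩ := hS
  refine ⟨fun t ↦ φ.symm (φ ⟨p, hp⟩ + (t : AddCircle (1 : ℝ))), ?_, ?_, ?_, ?_⟩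
  · exact continuous_subtype_val.comp
      (φ.symm.continuous.comp (continuous_const.add (AddCircle.continuous_mk' 1)))
  · simp
  · intro t
    simp only [AddCircle.coe_add_period]
  · intro s t hst h
    have h' := add_left_cancel (φ.symm.injective (Subtype.ext h))
    obtain ⟨n, hn⟩ := (AddCircle.coe_eq_zero_iff (1 : ℝ)).1
      (show ((s - t : ℝ) : AddCircle (1 : ℝ)) = 0 by rw [AddCircle.coe_sub, h', sub_self])
    rw [zsmul_eq_mul, mul_one] at hn
    rw [← hn] at hst
    have : n = 0 := Int.abs_lt_one_iff.1 (by exact_mod_cast hst)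
    rw [this, Int.cast_zero] at hn
    linarith

/-- If a local dendrite deforms into a closed set, this set contains all simple closed curves. -/
theorem IsSimpleClosedCurve.subset_of_deformation {X : Type*} [MetricSpace X]
    (hX : IsLocalDendrite X) {G : Set X} (hG : IsClosed G) {h : unitInterval × X → X}
    (hh : Continuous h) (h0 : ∀ x, h (0, x) = x) (h1 : ∀ x, h (1, x) ∈ G) {S : Set X}
    (hS : IsSimpleClosedCurve S) : S ⊆ G := by
  classical
  intro p hpS
  by_contra hpG
  obtain ⟨e, he, he0, hper, hinj⟩ := hS.exists_periodic hpS
  obtain ⟨N, hN, ⟨-, hNcomp, -, -⟩, hNl, hNS⟩ := hX.2 p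
  obtain ⟨ρ', hρ', hball⟩ := Metric.mem_nhds_iff.1 (inter_mem hN (hG.isOpen_compl.mem_nhds hpG))
  obtain ⟨δ', hδ', hδball⟩ := Metric.mem_nhds_iff.1
    (he.continuousAt.preimage_mem_nhds (Metric.ball_mem_nhds (e 0) hρ'))
  rw [he0] at hδball
  obtain ⟨δ, hδ, hδlt, hδ4⟩ : ∃ δ : ℝ, 0 < δ ∧ δ < δ' ∧ δ ≤ 1 / 4 :=
    ⟨min (δ' / 2) (1 / 4), by positivity, by linarith [min_le_left (δ' / 2) (1 / 4)],
      min_le_right _ _⟩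
  have hfar : ∀ t ∈ Icc δ (1 - δ), e t ≠ p := fun t ht h ↦ by
    have := hinj t 0 (by rw [sub_zero, abs_of_pos (hδ.trans_le ht.1)]; linarith [ht.2])
      (h.trans he0.symm)
    linarith [ht.1]
  have hmem : ∀ s : unitInterval, e (-δ + 2 * δ * s) ∈ Metric.ball p ρ' := fun s ↦ by
    refine hδball (a := -δ + 2 * δ * s) ?_
    rw [mem_ball_zero_iff, Real.norm_eq_abs, abs_lt]
    have := s.2.1
    have := s.2.2
    constructor <;> nlinarith
  let α : unitInterval → N := fun s ↦ ⟨e (-δ + 2 * δ * s), (hball (hmem s)).1⟩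
  have hα : Continuous α := by fun_prop
  have hαi : Function.Injective α := fun s t hst ↦ by
    have := hinj _ _ (by
      rw [abs_lt]
      have := s.2.1
      have := s.2.2
      have := t.2.1
      have := t.2.2
      constructor <;> nlinarith) (congrArg Subtype.val hst)
    exact Subtype.ext (mul_left_cancel₀ (by positivity : 2 * δ ≠ 0) (by linarith))
  let m : unitInterval := ⟨1 / 2, by norm_num⟩
  have hαm : (α m : X) = p := by
    rw [← he0]
    change e (-δ + 2 * δ * (1 / 2)) = e 0
    congr 1
    ring
  have hα0 : (α 0 : X) = e (1 - δ) := by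
    rw [show 1 - δ = -δ + 1 by ring, hper]
    simp [α]
  have hα1 : (α 1 : X) = e δ := by
    change e (-δ + 2 * δ * 1) = e δ
    congr 1
    ring
  obtain ⟨ρ, hρ, hρρ', hρe⟩ : ∃ ρ > 0, ρ < ρ' ∧ ∀ t ∈ Icc δ (1 - δ), ρ ≤ dist (e t) p := by
    obtain ⟨t₀, ht₀, hmin⟩ := (isCompact_Icc (a := δ) (b := 1 - δ)).exists_isMinOn
      ⟨δ, le_rfl, by linarith⟩ (f := fun t ↦ dist (e t) p) (by fun_prop)
    refine ⟨min (dist (e t₀) p) (ρ' / 2), lt_min (dist_pos.2 (hfar t₀ ht₀)) (half_pos hρ'),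
      by linarith [min_le_right (dist (e t₀) p) (ρ' / 2)], fun t ht ↦
      (min_le_left _ _).trans (hmin ht)⟩
  have hδmem : δ ∈ Icc δ (1 - δ) := ⟨le_rfl, by linarith⟩
  have hδmem' : 1 - δ ∈ Icc δ (1 - δ) := ⟨by linarith, le_rfl⟩
  obtain ⟨u, hu, hu0, hu1, huρ⟩ := exists_separating_function hNS hα hαi (s := m) hρ
    (by rw [Subtype.dist_eq, hα0, hαm]; exact hρe _ hδmem')
    (by rw [Subtype.dist_eq, hα1, hαm]; exact hρe _ hδmem)
  let f : X → AddCircle (1 : ℝ) := fun x ↦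
    if hx : x ∈ N then (u ⟨x, hx⟩ : AddCircle (1 : ℝ)) else 0
  have hfN : ∀ x : N, f x = (u x : AddCircle (1 : ℝ)) := fun x ↦ dif_pos x.2
  have hf0 : ∀ x, ρ ≤ dist x p → f x = 0 := by
    intro x hx
    by_cases hxN : x ∈ N
    · rw [hfN ⟨x, hxN⟩]
      rcases huρ ⟨x, hxN⟩ (by rw [Subtype.dist_eq, hαm]; exact hx) with h | h
      · rw [h, AddCircle.coe_zero]
      · rw [h, AddCircle.coe_period]
    · exact dif_neg hxN
  have hf : Continuous f := by
    refine continuous_iff_continuousAt.2 fun x ↦ ?_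
    by_cases hx : dist x p < ρ'
    · have hxN : N ∈ 𝓝 x := mem_of_superset (Metric.isOpen_ball.mem_nhds hx)
        fun y hy ↦ (hball hy).1
      have : ContinuousOn f N := continuousOn_iff_continuous_domRestrict.2 (by
        rw [show N.domRestrict f = fun x ↦ (u x : AddCircle (1 : ℝ)) from funext hfN]
        exact (AddCircle.continuous_mk' 1).comp hu)
      exact this.continuousAt hxN
    · have : f =ᶠ[𝓝 x] fun _ ↦ 0 := by
        filter_upwards [(continuous_id.dist continuous_const).continuousAt.eventually
          (lt_mem_nhds (hρρ'.trans_le (not_lt.1 hx)))] with y hy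
        exact hf0 y hy.le
      exact continuousAt_const.congr this.symm
  obtain ⟨F, hF, hFf⟩ := exists_lift_of_homotopy hh h0 hf fun x ↦ hf0 _ (by
    by_contra hx
    exact (hball (Metric.mem_ball.2 ((not_le.1 hx).trans hρρ'))).2 (h1 x))
  have h_near : F (α 0) - u (α 0) = F (α 1) - u (α 1) :=
    (isPreconnected_univ (α := unitInterval)).eq_of_coe_addCircle_eq_zero
      (g := fun s ↦ F (α s) - u (α s)) (by fun_prop)
      (fun s _ ↦ by rw [AddCircle.coe_sub, hFf, hfN, sub_self]) (mem_univ 0) (mem_univ 1)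
  have h_far : F (e δ) = F (e (1 - δ)) :=
    (isPreconnected_Icc (a := δ) (b := 1 - δ)).eq_of_coe_addCircle_eq_zero (g := fun t ↦ F (e t))
      (by fun_prop) (fun t ht ↦ (hFf _).trans (hf0 _ (hρe t ht))) hδmem hδmem'
  rw [hu0, hu1, hα0, hα1, h_far] at h_near
  linarith

/-- For a subcontinuum `G` of a local dendrite `X`, the following are
equivalent: (1) `G` contains every simple closed curve of `X`; (2) `G` is a deformation
retract of `X`; (3) `G` is a strong deformation retract of `X`. -/
theorem subcontinuum_deformation_retract_tfae
    {X : Type u} [TopologicalSpace X] (hX : IsLocalDendrite X)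
    (G : Set X) (hG : IsContinuum G) :
    ((∀ S : Set X, IsSimpleClosedCurve S → S ⊆ G) ↔
      (∃ (r : X → X) (h : unitInterval × X → X),
        Continuous r ∧ Set.range r = G ∧ (∀ g ∈ G, r g = g) ∧
        Continuous h ∧ (∀ x, h (0, x) = x) ∧ (∀ x, h (1, x) = r x))) ∧
    ((∃ (r : X → X) (h : unitInterval × X → X),
        Continuous r ∧ Set.range r = G ∧ (∀ g ∈ G, r g = g) ∧
        Continuous h ∧ (∀ x, h (0, x) = x) ∧ (∀ x, h (1, x) = r x)) ↔
      (∃ (r : X → X) (h : unitInterval × X → X),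
        Continuous r ∧ Set.range r = G ∧ (∀ g ∈ G, r g = g) ∧
        Continuous h ∧ (∀ x, h (0, x) = x) ∧ (∀ x, h (1, x) = r x) ∧
        (∀ t : unitInterval, ∀ g ∈ G, h (t, g) = g))) := by
  have hl := hX.locallyConnectedSpace
  have hX' := hX
  obtain ⟨⟨-, _, _, _⟩, -⟩ := hX'
  obtain ⟨hGne, hGcomp, hGconn, -⟩ := hG
  let _ : MetricSpace X := TopologicalSpace.metrizableSpaceMetric X
  have hGc : IsClosed G := (isCompact_iff_compactSpace.2 hGcomp).isClosed
  have hGp : IsPreconnected G := (isConnected_iff_connectedSpace.2 hGconn).isPreconnected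
  have hGn : G.Nonempty := nonempty_coe_sort.1 hGne
  have to_strong : (∀ S : Set X, IsSimpleClosedCurve S → S ⊆ G) →
      ∃ (r : X → X) (h : unitInterval × X → X),
        Continuous r ∧ Set.range r = G ∧ (∀ g ∈ G, r g = g) ∧
        Continuous h ∧ (∀ x, h (0, x) = x) ∧ (∀ x, h (1, x) = r x) ∧
        (∀ t : unitInterval, ∀ g ∈ G, h (t, g) = g) := by
    intro hS
    obtain ⟨h, hh, h0, h1, hg⟩ := exists_strongDeformationRetraction hGc hGp hGn hS
    exact ⟨fun x ↦ h (1, x), h, by fun_prop, subset_antisymm (range_subset_iff.2 h1)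
      fun g hgG ↦ ⟨g, hg 1 g hgG⟩, hg 1, hh, h0, fun _ ↦ rfl, hg⟩
  have of_weak : (∃ (r : X → X) (h : unitInterval × X → X),
      Continuous r ∧ Set.range r = G ∧ (∀ g ∈ G, r g = g) ∧
      Continuous h ∧ (∀ x, h (0, x) = x) ∧ (∀ x, h (1, x) = r x)) →
      ∀ S : Set X, IsSimpleClosedCurve S → S ⊆ G := by
    rintro ⟨r, h, -, hr, -, hh, h0, h1⟩ S hS
    exact hS.subset_of_deformation hX hGc hh h0 fun x ↦ hr ▸ h1 x ▸ mem_range_self x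
  have weaken : (∃ (r : X → X) (h : unitInterval × X → X),
      Continuous r ∧ Set.range r = G ∧ (∀ g ∈ G, r g = g) ∧
      Continuous h ∧ (∀ x, h (0, x) = x) ∧ (∀ x, h (1, x) = r x) ∧
      (∀ t : unitInterval, ∀ g ∈ G, h (t, g) = g)) →
      ∃ (r : X → X) (h : unitInterval × X → X),
        Continuous r ∧ Set.range r = G ∧ (∀ g ∈ G, r g = g) ∧
        Continuous h ∧ (∀ x, h (0, x) = x) ∧ (∀ x, h (1, x) = r x) := by
    rintro ⟨r, h, hr, hrG, hrg, hh, h0, h1, -⟩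
    exact ⟨r, h, hr, hrG, hrg, hh, h0, h1⟩
  exact ⟨⟨fun h ↦ weaken (to_strong h), of_weak⟩, fun h ↦ to_strong (of_weak h), weaken⟩
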